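/- Birth-death lower bound for the spectral gap: assume that for every D ⊆ J̃ the overall balance condition η_j·Σ_{i∈J̃∖D} r^D_{ji} = Σ_{i∈J̃∖D} η_i r^D_{ij} holds for all j ∈ J̃∖D, and that r^D_{0i} > 0 and r^D_{i0} > 0 for every i ∈ J̃∖D. Let Z′ be the unreliable Jackson network with the same λ, μ_j, A, B and with rerouting matrices R′^D defined by r′^D_{00} = r^D_{00}, r′^D_{0i} = r^D_{0i}, r′^D_{i0} = r^D_{i0}, r′^D_{ii} = 1 − r^D_{i0} (i ∈ J̃∖D), and r′^D_{ij} = 0 for distinct i, j ∈ J̃∖D. Then Z′ has the same stationary distribution π̃ as Z, and Gap(Q^{Z′}) ≤ Gap(Q^Z). -/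

import Mathlib

open scoped BigOperators

noncomputable section

namespace UnrelNet

/-- State space of the unreliable Jackson network: a set of broken-down nodes
together with a queue-length vector. -/
abbrev Est (J : ℕ) := Finset (Fin J) × (Fin J → ℕ)

/-- The extended node set `J̃₀ ∖ D`: the exterior node `none` together with
the up nodes (complement of `D`). -/
def ext (J : ℕ) (D : Finset (Fin J)) : Finset (Option (Fin J)) :=
  insert none (Dᶜ.image Option.some)

/-- Unit vector `e_j` of `ℕ^J̃`, with `e_0 = 0` (index `none`). -/
def eV {J : ℕ} (o : Option (Fin J)) : Fin J → ℕ := fun i =>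
  match o with
  | none => 0
  | some j => if i = j then 1 else 0

/-- Breakdown/repair generator `Q^Y`. -/
def QY {J : ℕ} (A B : Finset (Fin J) → ℝ) (f : Finset (Fin J) → ℝ)
    (D : Finset (Fin J)) : ℝ :=
  (∑ H ∈ Finset.univ.filter (fun H => H ⊂ D), B D / B H * (f H - f D))
    + ∑ I ∈ Finset.univ.filter (fun I => D ⊂ I), A I / A D * (f I - f D)

/-- Off-diagonal breakdown/repair rates. -/
def qY0 {J : ℕ} (A B : Finset (Fin J) → ℝ) (D E : Finset (Fin J)) : ℝ :=
  if D ⊂ E then A E / A D else if E ⊂ D then B D / B E else 0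

/-- Breakdown/repair rate matrix `q^Y`, including the diagonal. -/
def qY {J : ℕ} (A B : Finset (Fin J) → ℝ) (D E : Finset (Fin J)) : ℝ :=
  if E = D then -∑ F, qY0 A B D F else qY0 A B D E

/-- Breakdown/repair generator written via the rate matrix. -/
def QYm {J : ℕ} (A B : Finset (Fin J) → ℝ) (f : Finset (Fin J) → ℝ)
    (D : Finset (Fin J)) : ℝ :=
  ∑ E, qY A B D E * f E

/-- Normalisation constant `Ĉ`. -/
def Chat {J : ℕ} (A B : Finset (Fin J) → ℝ) : ℝ := ∑ D, A D / B D

/-- Stationary distribution `π̂` of the breakdown/repair process. -/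
def piY {J : ℕ} (A B : Finset (Fin J) → ℝ) (D : Finset (Fin J)) : ℝ :=
  (A D / B D) / Chat A B

/-- `Π_{i=1}^{k} η_j/μ_j(i)`. -/
def prodK {J : ℕ} (η : Fin J → ℝ) (μ : Fin J → ℕ → ℝ) (j : Fin J) (k : ℕ) : ℝ :=
  ∏ i ∈ Finset.range k, η j / μ j (i + 1)

/-- Normalisation constant `C_j`. -/
def Cnorm {J : ℕ} (η : Fin J → ℝ) (μ : Fin J → ℕ → ℝ) (j : Fin J) : ℝ :=
  ∑' k : ℕ, prodK η μ j k

/-- Product-form stationary distribution `π` of the Jackson network. -/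
def piX {J : ℕ} (η : Fin J → ℝ) (μ : Fin J → ℕ → ℝ) (n : Fin J → ℕ) : ℝ :=
  ∏ j, prodK η μ j (n j) / Cnorm η μ j

/-- Product measure `π̃(D,n) = π̂(D)·π(n)`. -/
def piZ {J : ℕ} (η : Fin J → ℝ) (μ : Fin J → ℕ → ℝ) (A B : Finset (Fin J) → ℝ)
    (x : Est J) : ℝ :=
  piY A B x.1 * piX η μ x.2

/-- Generator `Q^Z` of the unreliable Jackson network. -/
def QZ {J : ℕ} (lam : ℝ) (μ : Fin J → ℕ → ℝ)
    (r : Finset (Fin J) → Option (Fin J) → Option (Fin J) → ℝ)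
    (A B : Finset (Fin J) → ℝ) (f : Est J → ℝ) (x : Est J) : ℝ :=
  (∑ j ∈ x.1ᶜ, lam * r x.1 none (some j) * (f (x.1, x.2 + eV (some j)) - f x))
    + (∑ j ∈ x.1ᶜ, μ j (x.2 j) * r x.1 (some j) none * (f (x.1, x.2 - eV (some j)) - f x))
    + (∑ j ∈ x.1ᶜ, ∑ i ∈ x.1ᶜ,
        μ j (x.2 j) * r x.1 (some j) (some i) * (f (x.1, x.2 - eV (some j) + eV (some i)) - f x))
    + (∑ H ∈ Finset.univ.filter (fun H => H ⊂ x.1), B x.1 / B H * (f (H, x.2) - f x))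
    + ∑ I ∈ Finset.univ.filter (fun I => x.1 ⊂ I), A I / A x.1 * (f (I, x.2) - f x)

/-- Transition-rate matrix `q^Z` of the unreliable Jackson network
(between distinct states; the diagonal is set to `0`). -/
def qZ {J : ℕ} (lam : ℝ) (μ : Fin J → ℕ → ℝ)
    (r : Finset (Fin J) → Option (Fin J) → Option (Fin J) → ℝ)
    (A B : Finset (Fin J) → ℝ) (x y : Est J) : ℝ :=
  if x = y then 0
  else
    (if y.1 = x.1 then
        ∑ j ∈ x.1ᶜ,
          ((if y.2 = x.2 + eV (some j) then lam * r x.1 none (some j) else 0)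
            + (if y.2 + eV (some j) = x.2 then μ j (x.2 j) * r x.1 (some j) none else 0)
            + ∑ i ∈ x.1ᶜ,
                if i ≠ j ∧ y.2 + eV (some j) = x.2 + eV (some i) then
                  μ j (x.2 j) * r x.1 (some j) (some i)
                else 0)
      else 0)
    + (if y.2 = x.2 then
        (if y.1 ⊂ x.1 then B x.1 / B y.1 else 0) + (if x.1 ⊂ y.1 then A y.1 / A x.1 else 0)
      else 0)

/-- Extension `η^D` of the traffic solution: `η^D_0 = λ`, `η^D_j = η_j`. -/
def etaE {J : ℕ} (lam : ℝ) (η : Fin J → ℝ) : Option (Fin J) → ℝ := fun o => o.elim lam η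

/-- Normalised routing-equilibrium vector `ξ^D`. -/
def xiV {J : ℕ} (lam : ℝ) (η : Fin J → ℝ) (D : Finset (Fin J))
    (o : Option (Fin J)) : ℝ :=
  etaE lam η o / ∑ k ∈ ext J D, etaE lam η k

/-- Spectral gap of a generator on the network state space w.r.t. a measure `m`. -/
def GapZ {J : ℕ} (m : Est J → ℝ) (Q : (Est J → ℝ) → Est J → ℝ) : ℝ :=
  sInf {v : ℝ | ∃ f : Est J → ℝ,
    Summable (fun x => f x * f x * m x) ∧ (∑' x, f x * m x) = 0 ∧
      (∑' x, f x * f x * m x) = 1 ∧ v = ∑' x, f x * -(Q f x) * m x}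

/-- Spectral gap of a generator on `2^{J̃}` w.r.t. a probability vector `m`. -/
def GapY {J : ℕ} (m : Finset (Fin J) → ℝ)
    (Q : (Finset (Fin J) → ℝ) → Finset (Fin J) → ℝ) : ℝ :=
  sInf {v : ℝ | ∃ f : Finset (Fin J) → ℝ,
    (∑ D, m D * f D) = 0 ∧ (∑ D, m D * f D ^ 2) = 1 ∧
      v = -(∑ D, m D * f D * Q f D)}

/-- Merge a vector indexed by `D` with a vector indexed by `J̃∖D`. -/
def merge {J : ℕ} (D : Finset (Fin J)) (a : {j : Fin J // j ∈ D} → ℕ)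
    (b : {j : Fin J // j ∉ D} → ℕ) : Fin J → ℕ := fun j =>
  if h : j ∈ D then a ⟨j, h⟩ else b ⟨j, h⟩

/-- Marginal product-form density on a sub-collection of nodes. -/
def piSub {J : ℕ} (η : Fin J → ℝ) (μ : Fin J → ℕ → ℝ) (p : Fin J → Prop)
    [DecidablePred p] (a : {j : Fin J // p j} → ℕ) : ℝ :=
  ∏ j : {j : Fin J // p j}, prodK η μ j.1 (a j) / Cnorm η μ j.1

/-- Unit vector on a subtype index set. -/
def eS {J : ℕ} {p : Fin J → Prop} (j : {k : Fin J // p k}) :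
    {k : Fin J // p k} → ℕ := fun i => if i = j then 1 else 0

/-- Generator of the synthetic subnetwork on the up nodes `J̃∖D`. -/
def QXsub {J : ℕ} (lam : ℝ) (μ : Fin J → ℕ → ℝ)
    (r : Finset (Fin J) → Option (Fin J) → Option (Fin J) → ℝ)
    (D : Finset (Fin J)) (h : ({j : Fin J // j ∉ D} → ℕ) → ℝ)
    (m : {j : Fin J // j ∉ D} → ℕ) : ℝ :=
  (∑ j : {j : Fin J // j ∉ D}, lam * r D none (some j.1) * (h (m + eS j) - h m))
    + (∑ j : {j : Fin J // j ∉ D}, μ j.1 (m j) * r D (some j.1) none * (h (m - eS j) - h m))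
    + ∑ j : {j : Fin J // j ∉ D}, ∑ i : {j : Fin J // j ∉ D},
        μ j.1 (m j) * r D (some j.1) (some i.1) * (h (m - eS j + eS i) - h m)

/-- Transition-rate matrix `q^X` of the (reliable) Jackson network. -/
def qX {J : ℕ} (lam : ℝ) (μ : Fin J → ℕ → ℝ)
    (r : Option (Fin J) → Option (Fin J) → ℝ) (n m : Fin J → ℕ) : ℝ :=
  if n = m then 0
  else
    ∑ j : Fin J,
      ((if m = n + eV (some j) then lam * r none (some j) else 0)
        + (if m + eV (some j) = n then μ j (n j) * r (some j) none else 0)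
        + ∑ i : Fin J,
            if i ≠ j ∧ m + eV (some j) = n + eV (some i) then
              μ j (n j) * r (some j) (some i)
            else 0)

/-- One-step Markov operator `K = Id + ε·Q`. -/
def Kop {J : ℕ} (ε : ℝ) (Q : (Est J → ℝ) → Est J → ℝ) :
    (Est J → ℝ) → Est J → ℝ := fun h x => h x + ε * Q h x

def GoodOp {α : Type*} (m : α → ℝ) (L : (α → ℝ) → α → ℝ) : Prop :=
  ∃ K : ℝ, ∀ f : α → ℝ, Summable (fun x => f x * f x * m x) →
    Summable (fun x => f x * L f x * m x) ∧
      ∑' x, f x * L f x * m x ≤ K * ∑' x, f x * f x * m x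

lemma GoodOp.add {α : Type*} {m : α → ℝ} {L L' : (α → ℝ) → α → ℝ}
    (h : GoodOp m L) (h' : GoodOp m L') : GoodOp m (fun f x => L f x + L' f x) := by
  obtain ⟨K, h⟩ := h
  obtain ⟨K', h'⟩ := h'
  refine ⟨K + K', fun f hf => ?_⟩
  obtain ⟨h1, h2⟩ := h f hf
  obtain ⟨h3, h4⟩ := h' f hf
  have e : (fun x => f x * (L f x + L' f x) * m x)
      = fun x => f x * L f x * m x + f x * L' f x * m x := by
    funext x; ring
  refine ⟨by rw [e]; exact h1.add h3, ?_⟩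
  rw [e, h1.tsum_add h3]
  linarith

lemma GoodOp.zero {α : Type*} {m : α → ℝ} : GoodOp m (fun _ _ => 0) :=
  ⟨0, fun f _ => by simp [summable_zero]⟩

lemma GoodOp.sum {α ι : Type*} {m : α → ℝ} (s : Finset ι) (L : ι → (α → ℝ) → α → ℝ)
    (h : ∀ i, GoodOp m (L i)) : GoodOp m (fun f x => ∑ i ∈ s, L i f x) := by
  classical
  induction s using Finset.induction_on with
  | empty => simpa using GoodOp.zero
  | insert a s ha ih =>
    simp only [Finset.sum_insert ha]
    exact (h a).add ih

lemma GoodOp.jump {α : Type*} {m : α → ℝ} (hm : ∀ x, 0 ≤ m x) (w : α → ℝ) (T : α → α)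
    (C1 C2 : ℝ) (hC2 : 0 ≤ C2)
    (hw : ∀ x, 0 ≤ w x) (hw1 : ∀ x, w x ≤ C1)
    (hT : Set.InjOn T {x | w x ≠ 0})
    (hw2 : ∀ x, w x ≠ 0 → w x * m x ≤ C2 * m (T x)) :
    GoodOp m (fun f x => w x * (f (T x) - f x)) := by
  refine ⟨C2, fun f hf => ?_⟩
  set g : α → ℝ := fun x => f x * f x * m x with hg
  have hg0 : ∀ x, 0 ≤ g x := fun x => mul_nonneg (mul_self_nonneg _) (hm x)
  set S : Set α := {x | w x ≠ 0}
  have hinj : Function.Injective (fun x : S => T x) := fun a b h =>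
    Subtype.ext (hT a.2 b.2 h)
  have hs1 : Summable (fun x : S => g (T x)) := hf.comp_injective hinj
  have hs2 : Summable (S.indicator (fun x => g (T x))) :=
    summable_subtype_iff_indicator.1 hs1
  have hle : ∑' x, S.indicator (fun x => g (T x)) x ≤ ∑' x, g x := by
    rw [← tsum_subtype S (fun x => g (T x))]
    exact tsum_comp_le_tsum_of_inj hf hg0 hinj
  set I := S.indicator (fun x => g (T x)) with hI
  have key : ∀ x, w x * (f (T x) * f (T x)) * m x ≤ C2 * I x := by
    intro x
    by_cases hx : w x ≠ 0
    · have : I x = g (T x) := Set.indicator_of_mem (show x ∈ S from hx) _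
      rw [this]
      have := mul_le_mul_of_nonneg_right (hw2 x hx) (mul_self_nonneg (f (T x)))
      simp only [hg]
      nlinarith
    · have h0 : I x = 0 := Set.indicator_of_notMem (show x ∉ S from hx) _
      rw [h0]
      push Not at hx
      simp [hx]
  have key1 : ∀ x, w x * (f x * f x) * m x ≤ C1 * g x := by
    intro x
    have := mul_le_mul_of_nonneg_right (hw1 x) (hg0 x)
    simp only [hg] at this ⊢
    linarith
  have hwm : ∀ x, 0 ≤ w x * m x := fun x => mul_nonneg (hw x) (hm x)
  have hsum : Summable (fun x => f x * (w x * (f (T x) - f x)) * m x) := by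
    refine Summable.of_norm_bounded (g := fun x => 2 * C1 * g x + C2 * I x)
      ((hf.mul_left _).add (hs2.mul_left _)) (fun x => ?_)
    rw [Real.norm_eq_abs, abs_le]
    have a := key x
    have b := key1 x
    have c := mul_nonneg (hwm x) (sq_nonneg (f x - f (T x)))
    have d := mul_nonneg (hwm x) (sq_nonneg (f x + f (T x)))
    have e := mul_nonneg (hwm x) (sq_nonneg (f x))
    have e' := mul_nonneg (hwm x) (sq_nonneg (f (T x)))
    constructor <;> nlinarith
  refine ⟨hsum, ?_⟩
  calc _ ≤ ∑' x, C2 * I x := by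
        refine hsum.tsum_le_tsum (fun x => ?_) (hs2.mul_left _)
        have a := key x
        have c := mul_nonneg (hwm x) (sq_nonneg (f x - f (T x)))
        have e := mul_nonneg (hwm x) (sq_nonneg (f x))
        have e' := mul_nonneg (hwm x) (sq_nonneg (f (T x)))
        nlinarith
    _ = C2 * ∑' x, I x := tsum_mul_left
    _ ≤ _ := mul_le_mul_of_nonneg_left hle hC2

lemma eV_self {J : ℕ} (j : Fin J) : eV (some j) j = 1 := by simp [eV]

lemma eV_ne {J : ℕ} {i j : Fin J} (h : i ≠ j) : eV (some j) i = 0 := by simp [eV, h]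

lemma sub_add_eV {J : ℕ} (n : Fin J → ℕ) (j : Fin J) (h : n j ≠ 0) :
    n - eV (some j) + eV (some j) = n := by
  funext k
  by_cases hk : k = j
  · subst hk
    simp only [Pi.add_apply, Pi.sub_apply, eV_self]; omega
  · simp [eV_ne hk]

lemma add_sub_eV {J : ℕ} (n : Fin J → ℕ) (j : Fin J) :
    n + eV (some j) - eV (some j) = n := by
  funext k
  simp

section meas
variable {J : ℕ} {lam : ℝ} {μ : Fin J → ℕ → ℝ} {η : Fin J → ℝ} {A B : Finset (Fin J) → ℝ}

lemma prodK_pos (hμpos : ∀ j k, k ≠ 0 → 0 < μ j k) (hη : ∀ j, 0 < η j) (j : Fin J) (k : ℕ) :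
    0 < prodK η μ j k :=
  Finset.prod_pos fun i _ => div_pos (hη j) (hμpos j _ (Nat.succ_ne_zero i))

lemma Cnorm_pos (hμpos : ∀ j k, k ≠ 0 → 0 < μ j k) (hη : ∀ j, 0 < η j)
    (hC : ∀ j, Summable (fun k => prodK η μ j k)) (j : Fin J) : 0 < Cnorm η μ j :=
  (hC j).tsum_pos (fun k => (prodK_pos hμpos hη j k).le) 0 (prodK_pos hμpos hη j 0)

lemma piX_pos (hμpos : ∀ j k, k ≠ 0 → 0 < μ j k) (hη : ∀ j, 0 < η j)
    (hC : ∀ j, Summable (fun k => prodK η μ j k)) (n : Fin J → ℕ) : 0 < piX η μ n :=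
  Finset.prod_pos fun j _ => div_pos (prodK_pos hμpos hη j _) (Cnorm_pos hμpos hη hC j)

lemma piY_pos (hApos : ∀ D, 0 < A D) (hBpos : ∀ D, 0 < B D) (D : Finset (Fin J)) :
    0 < piY A B D :=
  div_pos (div_pos (hApos D) (hBpos D))
    (Finset.sum_pos (fun E _ => div_pos (hApos E) (hBpos E)) ⟨∅, Finset.mem_univ _⟩)

lemma piX_shift (hμpos : ∀ j k, k ≠ 0 → 0 < μ j k) (n : Fin J → ℕ) (j : Fin J) :
    μ j (n j + 1) * piX η μ (n + eV (some j)) = η j * piX η μ n := by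
  unfold piX
  rw [← Finset.mul_prod_erase Finset.univ _ (Finset.mem_univ j),
    ← Finset.mul_prod_erase Finset.univ (fun k => prodK η μ k (n k) / _) (Finset.mem_univ j)]
  have e : ∏ k ∈ Finset.univ.erase j, prodK η μ k ((n + eV (some j)) k) / Cnorm η μ k
      = ∏ k ∈ Finset.univ.erase j, prodK η μ k (n k) / Cnorm η μ k := by
    refine Finset.prod_congr rfl fun k hk => ?_
    simp [eV_ne (Finset.ne_of_mem_erase hk)]
  rw [e]
  have h2 : prodK η μ j ((n + eV (some j)) j) = prodK η μ j (n j) * (η j / μ j (n j + 1)) := by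
    simp only [Pi.add_apply, eV_self, prodK, Finset.prod_range_succ]
  rw [h2]
  have := (hμpos j (n j + 1) (Nat.succ_ne_zero _)).ne'
  field_simp

lemma piZ_shift (hμpos : ∀ j k, k ≠ 0 → 0 < μ j k) (D : Finset (Fin J)) (n : Fin J → ℕ)
    (j : Fin J) :
    μ j (n j + 1) * piZ η μ A B (D, n + eV (some j)) = η j * piZ η μ A B (D, n) := by
  have := piX_shift (η := η) hμpos n j
  simp only [piZ]
  linear_combination piY A B D * this

lemma piZ_shift' (hμpos : ∀ j k, k ≠ 0 → 0 < μ j k) (D : Finset (Fin J)) (n : Fin J → ℕ)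
    (j : Fin J) (h : n j ≠ 0) :
    μ j (n j) * piZ η μ A B (D, n) = η j * piZ η μ A B (D, n - eV (some j)) := by
  have := piZ_shift (η := η) (A := A) (B := B) hμpos D (n - eV (some j)) j
  rw [sub_add_eV n j h] at this
  rw [← this]
  simp only [Pi.sub_apply, eV_self]
  congr 3; omega

lemma piY_bal (hApos : ∀ D, 0 < A D) (hBpos : ∀ D, 0 < B D) (D E : Finset (Fin J)) :
    piY A B D * (B D / B E) = piY A B E * (A D / A E) := by
  have h1 := (hApos D).ne'
  have h2 := (hApos E).ne'
  have h3 := (hBpos D).ne'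
  have h4 := (hBpos E).ne'
  unfold piY
  field_simp

lemma good_break (hμpos : ∀ j k, k ≠ 0 → 0 < μ j k) (hη : ∀ j, 0 < η j)
    (hC : ∀ j, Summable (fun k => prodK η μ j k))
    (hApos : ∀ D, 0 < A D) (hBpos : ∀ D, 0 < B D)
    (c : Finset (Fin J) → Finset (Fin J) → ℝ) (p : Finset (Fin J) → Finset (Fin J) → Prop)
    [∀ D E, Decidable (p D E)]
    (hc : ∀ D E, 0 ≤ c D E) :
    GoodOp (piZ η μ A B) (fun f x =>
      ∑ H ∈ Finset.univ.filter (fun H => p x.1 H), c x.1 H * (f (H, x.2) - f x)) := by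
  have e : (fun (f : Est J → ℝ) (x : Est J) =>
      ∑ H ∈ Finset.univ.filter (fun H => p x.1 H), c x.1 H * (f (H, x.2) - f x))
      = fun f x => ∑ H, ∑ D, (if x.1 = D ∧ p D H then c D H else 0) * (f (H, x.2) - f x) := by
    funext f x
    rw [Finset.sum_filter]
    refine Finset.sum_congr rfl fun H _ => ?_
    rw [Finset.sum_eq_single x.1]
    · by_cases h : p x.1 H <;> simp [h]
    · intro D _ hD
      simp [hD.symm]
    · simp
  rw [e]
  refine GoodOp.sum _ _ fun H => GoodOp.sum _ _ fun D => ?_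
  have hY := piY_pos hApos hBpos (J := J)
  refine GoodOp.jump (fun x => (mul_pos (hY _) (piX_pos hμpos hη hC _)).le)
    (fun x : Est J => if x.1 = D ∧ p D H then c D H else 0) (fun x => (H, x.2)) (c D H)
    (c D H * (piY A B D / piY A B H))
    (mul_nonneg (hc _ _) (div_pos (hY _) (hY _)).le) ?_ ?_ ?_ ?_
  · intro x; split_ifs; exacts [hc _ _, le_rfl]
  · intro x; split_ifs; exacts [le_rfl, hc _ _]
  · intro x hx y hy h
    simp only [Set.mem_ofPred_eq, ne_eq, ite_eq_right_iff, Classical.not_imp] at hx hy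
    simp only [Prod.mk.injEq, true_and] at h
    exact Prod.ext (hx.1.1.trans hy.1.1.symm) h
  · intro x hx
    simp only [ne_eq, ite_eq_right_iff, Classical.not_imp] at hx
    simp only [hx.1, and_self, if_true, piZ]
    have := (hY H).ne'
    apply le_of_eq
    try rw [hx.1.1]
    field_simp

lemma good_up (hlam : 0 < lam) (hμpos : ∀ j k, k ≠ 0 → 0 < μ j k) (hη : ∀ j, 0 < η j)
    (hC : ∀ j, Summable (fun k => prodK η μ j k))
    (hApos : ∀ D, 0 < A D) (hBpos : ∀ D, 0 < B D)
    (M : ℝ) (hM : ∀ j k, μ j k ≤ M)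
    (c : Finset (Fin J) → Fin J → ℝ) (hc : ∀ D, ∀ j ∈ Dᶜ, 0 ≤ c D j ∧ c D j ≤ 1) :
    GoodOp (piZ η μ A B) (fun f x =>
      ∑ j ∈ x.1ᶜ, lam * c x.1 j * (f (x.1, x.2 + eV (some j)) - f x)) := by
  have e : (fun (f : Est J → ℝ) (x : Est J) =>
      ∑ j ∈ x.1ᶜ, lam * c x.1 j * (f (x.1, x.2 + eV (some j)) - f x))
      = fun f x => ∑ j, (if j ∈ x.1ᶜ then lam * c x.1 j else 0) *
          (f (x.1, x.2 + eV (some j)) - f x) := by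
    funext f x
    simp only [ite_mul, zero_mul, Finset.sum_ite_mem, Finset.univ_inter]
  rw [e]
  refine GoodOp.sum _ _ fun j => ?_
  have hpi : ∀ x, 0 < piZ η μ A B x :=
    fun x => (mul_pos (piY_pos hApos hBpos _) (piX_pos hμpos hη hC _))
  have hM0 : 0 < M := (hμpos j 1 one_ne_zero).trans_le (hM j 1)
  refine GoodOp.jump (fun x => (hpi x).le)
    (fun x : Est J => if j ∈ x.1ᶜ then lam * c x.1 j else 0)
    (fun x => (x.1, x.2 + eV (some j))) lam (lam * (M / η j))
    (mul_nonneg hlam.le (div_pos hM0 (hη j)).le) ?_ ?_ ?_ ?_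
  · intro x; split_ifs with h
    exacts [mul_nonneg hlam.le (hc _ _ h).1, le_rfl]
  · intro x; split_ifs with h
    exacts [mul_le_of_le_one_right hlam.le (hc _ _ h).2, hlam.le]
  · intro x _ y _ h
    simp only [Prod.mk.injEq] at h
    exact Prod.ext h.1 (add_right_cancel h.2)
  · intro x hx
    simp only [ne_eq, ite_eq_right_iff, Classical.not_imp] at hx
    simp only [hx.1, if_true]
    have h1 : lam * c x.1 j * piZ η μ A B x ≤ lam * piZ η μ A B x :=
      mul_le_mul_of_nonneg_right (mul_le_of_le_one_right hlam.le (hc _ _ hx.1).2) (hpi x).le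
    have h2 := piZ_shift (η := η) (A := A) (B := B) hμpos x.1 x.2 j
    have h3 := mul_le_mul_of_nonneg_right (hM j (x.2 j + 1))
      (hpi (x.1, x.2 + eV (some j))).le
    have h4 : piZ η μ A B x ≤ M / η j * piZ η μ A B (x.1, x.2 + eV (some j)) := by
      rw [div_mul_eq_mul_div, le_div_iff₀ (hη j)]
      have : piZ η μ A B x = piZ η μ A B (x.1, x.2) := rfl
      rw [this]
      linarith
    have h5 := mul_le_mul_of_nonneg_left h4 hlam.le
    linarith

lemma good_down (hμ0 : ∀ j, μ j 0 = 0) (hμpos : ∀ j k, k ≠ 0 → 0 < μ j k) (hη : ∀ j, 0 < η j)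
    (hC : ∀ j, Summable (fun k => prodK η μ j k))
    (hApos : ∀ D, 0 < A D) (hBpos : ∀ D, 0 < B D)
    (M : ℝ) (hM : ∀ j k, μ j k ≤ M)
    (c : Finset (Fin J) → Fin J → ℝ) (hc : ∀ D, ∀ j ∈ Dᶜ, 0 ≤ c D j ∧ c D j ≤ 1) :
    GoodOp (piZ η μ A B) (fun f x =>
      ∑ j ∈ x.1ᶜ, μ j (x.2 j) * c x.1 j * (f (x.1, x.2 - eV (some j)) - f x)) := by
  have e : (fun (f : Est J → ℝ) (x : Est J) =>
      ∑ j ∈ x.1ᶜ, μ j (x.2 j) * c x.1 j * (f (x.1, x.2 - eV (some j)) - f x))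
      = fun f x => ∑ j, (if j ∈ x.1ᶜ then μ j (x.2 j) * c x.1 j else 0) *
          (f (x.1, x.2 - eV (some j)) - f x) := by
    funext f x
    simp only [ite_mul, zero_mul, Finset.sum_ite_mem, Finset.univ_inter]
  rw [e]
  refine GoodOp.sum _ _ fun j => ?_
  have hpi : ∀ x, 0 < piZ η μ A B x :=
    fun x => (mul_pos (piY_pos hApos hBpos _) (piX_pos hμpos hη hC _))
  have hM0 : 0 < M := (hμpos j 1 one_ne_zero).trans_le (hM j 1)
  have hμ : ∀ k, 0 ≤ μ j k := fun k => by
    by_cases hk : k = 0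
    · rw [hk, hμ0]
    · exact (hμpos j k hk).le
  refine GoodOp.jump (fun x => (hpi x).le)
    (fun x : Est J => if j ∈ x.1ᶜ then μ j (x.2 j) * c x.1 j else 0)
    (fun x => (x.1, x.2 - eV (some j))) M (η j) (hη j).le ?_ ?_ ?_ ?_
  · intro x; split_ifs with h
    exacts [mul_nonneg (hμ _) (hc _ _ h).1, le_rfl]
  · intro x; split_ifs with h
    exacts [(mul_le_of_le_one_right (hμ _) (hc _ _ h).2).trans (hM _ _), hM0.le]
  · intro x hx y hy h
    simp only [Set.mem_ofPred_eq, ne_eq, ite_eq_right_iff, Classical.not_imp] at hx hy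
    simp only [Prod.mk.injEq] at h
    have hx' : x.2 j ≠ 0 := fun h0 => hx.2 (by rw [h0, hμ0, zero_mul])
    have hy' : y.2 j ≠ 0 := fun h0 => hy.2 (by rw [h0, hμ0, zero_mul])
    refine Prod.ext h.1 ?_
    rw [← sub_add_eV x.2 j hx', ← sub_add_eV y.2 j hy', h.2]
  · intro x hx
    simp only [ne_eq, ite_eq_right_iff, Classical.not_imp] at hx
    simp only [hx.1, if_true]
    have hx' : x.2 j ≠ 0 := fun h0 => hx.2 (by rw [h0, hμ0, zero_mul])
    have h1 : μ j (x.2 j) * c x.1 j * piZ η μ A B x ≤ μ j (x.2 j) * piZ η μ A B x :=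
      mul_le_mul_of_nonneg_right (mul_le_of_le_one_right (hμ _) (hc _ _ hx.1).2) (hpi x).le
    exact h1.trans (piZ_shift' (η := η) (A := A) (B := B) hμpos x.1 x.2 j hx').le

/-- one internal transition -/
def Lint (μ : Fin J → ℕ → ℝ) (c : Finset (Fin J) → Fin J → Fin J → ℝ) (j i : Fin J)
    (f : Est J → ℝ) (x : Est J) : ℝ :=
  (if j ∈ x.1ᶜ ∧ i ∈ x.1ᶜ then μ j (x.2 j) * c x.1 j i else 0) *
          (f (x.1, x.2 - eV (some j) + eV (some i)) - f x)

lemma good_int1 (hμ0 : ∀ j, μ j 0 = 0) (hμpos : ∀ j k, k ≠ 0 → 0 < μ j k) (hη : ∀ j, 0 < η j)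
    (hC : ∀ j, Summable (fun k => prodK η μ j k))
    (hApos : ∀ D, 0 < A D) (hBpos : ∀ D, 0 < B D)
    (M : ℝ) (hM : ∀ j k, μ j k ≤ M)
    (c : Finset (Fin J) → Fin J → Fin J → ℝ)
    (hc : ∀ D, ∀ j ∈ Dᶜ, ∀ i ∈ Dᶜ, 0 ≤ c D j i ∧ c D j i ≤ 1) (j i : Fin J) :
    GoodOp (piZ η μ A B) (Lint μ c j i) := by
  have hpi : ∀ x, 0 < piZ η μ A B x :=
    fun x => (mul_pos (piY_pos hApos hBpos _) (piX_pos hμpos hη hC _))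
  have hM0 : 0 < M := (hμpos j 1 one_ne_zero).trans_le (hM j 1)
  have hμ : ∀ k, 0 ≤ μ j k := fun k => by
    by_cases hk : k = 0
    · rw [hk, hμ0]
    · exact (hμpos j k hk).le
  refine GoodOp.jump (fun x => (hpi x).le)
    (fun x : Est J => if j ∈ x.1ᶜ ∧ i ∈ x.1ᶜ then μ j (x.2 j) * c x.1 j i else 0)
    (fun x => (x.1, x.2 - eV (some j) + eV (some i))) M (η j * (M / η i))
    (mul_nonneg (hη j).le (div_pos hM0 (hη i)).le) ?_ ?_ ?_ ?_
  · intro x; split_ifs with h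
    exacts [mul_nonneg (hμ _) (hc _ _ h.1 _ h.2).1, le_rfl]
  · intro x; split_ifs with h
    exacts [(mul_le_of_le_one_right (hμ _) (hc _ _ h.1 _ h.2).2).trans (hM _ _), hM0.le]
  · intro x hx y hy h
    simp only [Set.mem_ofPred_eq, ne_eq, ite_eq_right_iff, Classical.not_imp] at hx hy
    simp only [Prod.mk.injEq] at h
    have hx' : x.2 j ≠ 0 := fun h0 => hx.2 (by rw [h0, hμ0, zero_mul])
    have hy' : y.2 j ≠ 0 := fun h0 => hy.2 (by rw [h0, hμ0, zero_mul])
    refine Prod.ext h.1 ?_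
    rw [← sub_add_eV x.2 j hx', ← sub_add_eV y.2 j hy', add_right_cancel h.2]
  · intro x hx
    simp only [ne_eq, ite_eq_right_iff, Classical.not_imp] at hx
    simp only [hx.1, and_self, if_true]
    have hx' : x.2 j ≠ 0 := fun h0 => hx.2 (by rw [h0, hμ0, zero_mul])
    have h1 : μ j (x.2 j) * c x.1 j i * piZ η μ A B x ≤ μ j (x.2 j) * piZ η μ A B x :=
      mul_le_mul_of_nonneg_right
        (mul_le_of_le_one_right (hμ _) (hc _ _ hx.1.1 _ hx.1.2).2) (hpi x).le
    have h6 : μ j (x.2 j) * piZ η μ A B x = η j * piZ η μ A B (x.1, x.2 - eV (some j)) :=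
      piZ_shift' (η := η) (A := A) (B := B) hμpos x.1 x.2 j hx'
    set n := x.2 - eV (some j)
    have h2 := piZ_shift (η := η) (A := A) (B := B) hμpos x.1 n i
    have h3 := mul_le_mul_of_nonneg_right (hM i (n i + 1))
      (hpi (x.1, n + eV (some i))).le
    have h4 : piZ η μ A B (x.1, n) ≤ M / η i * piZ η μ A B (x.1, n + eV (some i)) := by
      rw [div_mul_eq_mul_div, le_div_iff₀ (hη i)]
      linarith
    have h5 := mul_le_mul_of_nonneg_left h4 (hη j).le
    linarith

lemma int_eq (c : Finset (Fin J) → Fin J → Fin J → ℝ) :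
    (fun (f : Est J → ℝ) (x : Est J) => ∑ j ∈ x.1ᶜ, ∑ i ∈ x.1ᶜ,
        μ j (x.2 j) * c x.1 j i * (f (x.1, x.2 - eV (some j) + eV (some i)) - f x))
      = fun f x => ∑ j, ∑ i, Lint μ c j i f x := by
  funext f x
  rw [← Finset.univ_inter x.1ᶜ, ← Finset.sum_ite_mem]
  refine Finset.sum_congr rfl fun j _ => ?_
  split_ifs with hj
  · rw [← Finset.sum_ite_mem]
    refine Finset.sum_congr rfl fun i _ => ?_
    by_cases hi : i ∈ x.1ᶜ <;> simp only [Lint, hi, hj, and_self, and_false, if_true, if_false, zero_mul]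
  · symm
    refine Finset.sum_eq_zero fun i _ => ?_
    simp only [Lint, hj, false_and, if_false, zero_mul]

lemma int_nonpos (hμ0 : ∀ j, μ j 0 = 0) (hμpos : ∀ j k, k ≠ 0 → 0 < μ j k)
    (hη : ∀ j, 0 < η j)
    (hC : ∀ j, Summable (fun k => prodK η μ j k))
    (hApos : ∀ D, 0 < A D) (hBpos : ∀ D, 0 < B D)
    (c : Finset (Fin J) → Fin J → Fin J → ℝ)
    (hc : ∀ D, ∀ j ∈ Dᶜ, ∀ i ∈ Dᶜ, 0 ≤ c D j i)
    (hbal : ∀ D : Finset (Fin J), ∀ j ∈ Dᶜ,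
      η j * (∑ i ∈ Dᶜ, c D j i) = ∑ i ∈ Dᶜ, η i * c D i j)
    (f : Est J → ℝ)
    (hs : ∀ j i, Summable (fun x => f x * Lint μ c j i f x * piZ η μ A B x)) :
    ∑' x, f x * (∑ j, ∑ i, Lint μ c j i f x) * piZ η μ A B x ≤ 0 := by
  have hpi : ∀ x, 0 < piZ η μ A B x :=
    fun x => (mul_pos (piY_pos hApos hBpos _) (piX_pos hμpos hη hC _))
  let H : Fin J → Fin J → Est J → ℝ := fun j i x =>
    (if j ∈ x.1ᶜ ∧ i ∈ x.1ᶜ then η j * c x.1 j i *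
      (f (x.1, x.2 + eV (some j)) * (f (x.1, x.2 + eV (some i)) - f (x.1, x.2 + eV (some j))))
      else 0) * piZ η μ A B x
  let up : Fin J → Est J → Est J := fun j x => (x.1, x.2 + eV (some j))
  have hup : ∀ j, Function.Injective (up j) := by
    intro j x y h
    simp only [up, Prod.mk.injEq] at h
    exact Prod.ext h.1 (add_right_cancel h.2)
  have hsupp : ∀ j i, ∀ x ∉ Set.range (up j), f x * Lint μ c j i f x * piZ η μ A B x = 0 := by
    intro j i x hx
    have h0 : x.2 j = 0 := by
      by_contra h0
      exact hx ⟨(x.1, x.2 - eV (some j)), by simp [up, sub_add_eV _ _ h0]⟩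
    simp [Lint, h0, hμ0]
  have hcomp : ∀ j i, (fun x => f x * Lint μ c j i f x * piZ η μ A B x) ∘ up j = H j i := by
    intro j i
    funext x
    have h := piZ_shift (η := η) (A := A) (B := B) hμpos x.1 x.2 j
    have h' : piZ η μ A B x = piZ η μ A B (x.1, x.2) := rfl
    simp only [Function.comp, up, Lint, H, add_sub_eV, Pi.add_apply, eV_self]
    split_ifs
    · rw [h']
      linear_combination (f (x.1, x.2 + eV (some j)) * c x.1 j i *
        (f (x.1, x.2 + eV (some i)) - f (x.1, x.2 + eV (some j)))) * h
    · simp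
  have hHs : ∀ j i, Summable (H j i) := fun j i => by
    rw [← hcomp]; exact (hs j i).comp_injective (hup j)
  have hHt : ∀ j i, ∑' x, f x * Lint μ c j i f x * piZ η μ A B x = ∑' x, H j i x := by
    intro j i
    rw [← hcomp]
    refine ((hup j).tsum_eq ?_).symm
    intro x hx
    by_contra h
    exact hx (hsupp j i x h)
  have e1 : (fun x => f x * (∑ j, ∑ i, Lint μ c j i f x) * piZ η μ A B x)
      = fun x => ∑ j, ∑ i, f x * Lint μ c j i f x * piZ η μ A B x := by
    funext x
    simp only [Finset.mul_sum, Finset.sum_mul]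
  rw [e1, Summable.tsum_finsetSum (fun j _ => summable_sum fun i _ => hs j i)]
  have e2 : ∀ j, ∑' x, ∑ i, f x * Lint μ c j i f x * piZ η μ A B x = ∑' x, ∑ i, H j i x := by
    intro j
    rw [Summable.tsum_finsetSum (fun i _ => hs j i),
      Summable.tsum_finsetSum (fun i _ => hHs j i)]
    exact Finset.sum_congr rfl fun i _ => hHt j i
  rw [Finset.sum_congr rfl fun j _ => e2 j,
    ← Summable.tsum_finsetSum (fun j _ => summable_sum fun i _ => hHs j i)]
  refine tsum_nonpos fun x => ?_
  simp only [H, ← Finset.sum_mul]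
  refine mul_nonpos_of_nonpos_of_nonneg ?_ (hpi x).le
  set F : Fin J → ℝ := fun j => f (x.1, x.2 + eV (some j)) with hF
  have e3 : (∑ j, ∑ i, if j ∈ x.1ᶜ ∧ i ∈ x.1ᶜ then η j * c x.1 j i * (F j * (F i - F j)) else 0)
      = ∑ j ∈ x.1ᶜ, ∑ i ∈ x.1ᶜ, η j * c x.1 j i * (F j * (F i - F j)) := by
    symm
    refine (Finset.sum_congr rfl fun j hj => ?_).trans
      (Finset.sum_subset (Finset.subset_univ x.1ᶜ) fun j _ hj => ?_)
    · refine (Finset.sum_congr rfl fun i hi => ?_).trans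
        (Finset.sum_subset (Finset.subset_univ x.1ᶜ) fun i _ hi => ?_)
      · rw [if_pos ⟨hj, hi⟩]
      · rw [if_neg (fun h => hi h.2)]
    · exact Finset.sum_eq_zero fun i _ => if_neg (fun h => hj h.1)
  change (∑ j, ∑ i, if j ∈ x.1ᶜ ∧ i ∈ x.1ᶜ then η j * c x.1 j i * (F j * (F i - F j)) else 0) ≤ 0
  rw [e3]
  calc _ ≤ ∑ j ∈ x.1ᶜ, ∑ i ∈ x.1ᶜ, (η j * c x.1 j i * (F i ^ 2 / 2) - η j * c x.1 j i * (F j ^ 2 / 2)) := by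
        refine Finset.sum_le_sum fun j hj => Finset.sum_le_sum fun i hi => ?_
        have := mul_nonneg (mul_nonneg (hη j).le (hc _ j hj i hi)) (sq_nonneg (F i - F j))
        nlinarith
    _ = 0 := by
        simp only [Finset.sum_sub_distrib]
        rw [Finset.sum_comm, ← Finset.sum_sub_distrib]
        refine Finset.sum_eq_zero fun j hj => ?_
        rw [← Finset.sum_mul, ← Finset.sum_mul, ← hbal _ j hj, Finset.mul_sum, sub_self]

end meas

/-- birth-death lower bound for the spectral gap.  Under overall
balance and positive entrance/departure probabilities, the feedback network `Z'`
has the same stationary distribution `π̃` (global balance holds) and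
`Gap(Q^{Z'}) ≤ Gap(Q^Z)`. -/
theorem gap_birth_death_lower_bound
    (J : ℕ) (hJ : 1 ≤ J)
    (lam : ℝ) (hlam : 0 < lam)
    (μ : Fin J → ℕ → ℝ)
    (hμ0 : ∀ j, μ j 0 = 0)
    (hμpos : ∀ j k, k ≠ 0 → 0 < μ j k)
    (hμbdd : ∃ M : ℝ, ∀ j k, μ j k ≤ M)
    (r : Finset (Fin J) → Option (Fin J) → Option (Fin J) → ℝ)
    (hrnn : ∀ D : Finset (Fin J), ∀ i ∈ ext J D, ∀ j ∈ ext J D, 0 ≤ r D i j)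
    (hrsto : ∀ D : Finset (Fin J), ∀ i ∈ ext J D, ∑ j ∈ ext J D, r D i j = 1)
    (η : Fin J → ℝ) (hη : ∀ j, 0 < η j)
    (htraffic : ∀ D : Finset (Fin J), ∀ j ∈ Dᶜ,
      η j = lam * r D none (some j) + ∑ i ∈ Dᶜ, η i * r D (some i) (some j))
    (A B : Finset (Fin J) → ℝ)
    (hApos : ∀ D, 0 < A D) (hBpos : ∀ D, 0 < B D)
    (hA0 : A (∅ : Finset (Fin J)) = 1) (hB0 : B (∅ : Finset (Fin J)) = 1)
    (hC : ∀ j, Summable (fun k => prodK η μ j k))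
    (hbal : ∀ D : Finset (Fin J), ∀ j ∈ Dᶜ,
      η j * (∑ i ∈ Dᶜ, r D (some j) (some i)) = ∑ i ∈ Dᶜ, η i * r D (some i) (some j))
    (hpos : ∀ D : Finset (Fin J), ∀ i ∈ Dᶜ,
      0 < r D none (some i) ∧ 0 < r D (some i) none) :
    ∀ r' : Finset (Fin J) → Option (Fin J) → Option (Fin J) → ℝ,
      (∀ D : Finset (Fin J), r' D none none = r D none none) →
      (∀ D : Finset (Fin J), ∀ i ∈ Dᶜ, r' D none (some i) = r D none (some i)
        ∧ r' D (some i) none = r D (some i) none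
        ∧ r' D (some i) (some i) = 1 - r D (some i) none) →
      (∀ D : Finset (Fin J), ∀ i ∈ Dᶜ, ∀ j ∈ Dᶜ, i ≠ j → r' D (some i) (some j) = 0) →
      ((∀ y : Est J,
          (∑' x : {x : Est J // x ≠ y}, piZ η μ A B x.1 * qZ lam μ r' A B x.1 y)
            = piZ η μ A B y * ∑' x : {x : Est J // x ≠ y}, qZ lam μ r' A B y x.1)
        ∧ GapZ (piZ η μ A B) (QZ lam μ r' A B) ≤ GapZ (piZ η μ A B) (QZ lam μ r A B)) := by
  intro r' _ h1 h2
  obtain ⟨M, hM⟩ := hμbdd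
  have hrout : ∀ D : Finset (Fin J), ∀ j ∈ Dᶜ, lam * r D none (some j) = η j * r D (some j) none := by
    intro D j hj
    have a := htraffic D j hj
    rw [← hbal D j hj] at a
    have b := hrsto D (some j) (by
      rw [ext]; exact Finset.mem_insert_of_mem (Finset.mem_image_of_mem _ hj))
    rw [ext, Finset.sum_insert (by simp),
      Finset.sum_image (by intro a _ b _ h; exact Option.some.inj h)] at b
    linear_combination -a - η j * b
  have hnone : ∀ D : Finset (Fin J), (none : Option (Fin J)) ∈ ext J D := fun D => by
    rw [ext]; exact Finset.mem_insert_self _ _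
  have hsome : ∀ D : Finset (Fin J), ∀ j ∈ Dᶜ, some j ∈ ext J D := fun D j hj => by
    rw [ext]; exact Finset.mem_insert_of_mem (Finset.mem_image_of_mem _ hj)
  have hr1 : ∀ D : Finset (Fin J), ∀ i ∈ ext J D, ∀ j ∈ ext J D, 0 ≤ r D i j ∧ r D i j ≤ 1 :=
    fun D i hi j hj => ⟨hrnn D i hi j hj, by
      rw [← hrsto D i hi]
      exact Finset.single_le_sum (f := fun j => r D i j) (fun k hk => hrnn D i hi k hk) hj⟩
  constructor
  · intro y
    rw [← tsum_mul_left]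
    refine tsum_congr fun x => ?_
    obtain ⟨⟨D, n⟩, hx⟩ := x
    obtain ⟨E, m⟩ := y
    have hx' : ((E, m) : Est J) ≠ (D, n) := fun h => hx h.symm
    simp only [qZ, if_neg hx, if_neg hx', mul_add]
    congr 1
    · by_cases hDE : E = D
      · subst hDE
        simp only [if_true, Finset.mul_sum]
        refine Finset.sum_congr rfl fun j hj => ?_
        have z1 : (∑ i ∈ Eᶜ, if i ≠ j ∧ m + eV (some j) = n + eV (some i) then
            μ j (n j) * r' E (some j) (some i) else 0) = 0 := by
          refine Finset.sum_eq_zero fun i hi => ?_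
          split_ifs with h
          · rw [h2 E j hj i hi h.1.symm, mul_zero]
          · rfl
        have z2 : (∑ i ∈ Eᶜ, if i ≠ j ∧ n + eV (some j) = m + eV (some i) then
            μ j (m j) * r' E (some j) (some i) else 0) = 0 := by
          refine Finset.sum_eq_zero fun i hi => ?_
          split_ifs with h
          · rw [h2 E j hj i hi h.1.symm, mul_zero]
          · rfl
        rw [z1, z2, (h1 E j hj).1, (h1 E j hj).2.1]
        have hr := hrout E j hj
        have aux : ∀ a b : Fin J → ℕ, piZ η μ A B (E, a) *
            (if b = a + eV (some j) then lam * r E none (some j) else 0)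
            = piZ η μ A B (E, b) *
              (if a + eV (some j) = b then μ j (b j) * r E (some j) none else 0) := by
          intro a b
          by_cases h : b = a + eV (some j)
          · subst h
            have := piZ_shift (η := η) (A := A) (B := B) hμpos E a j
            simp only [if_true, Pi.add_apply, eV_self]
            linear_combination piZ η μ A B (E, a) * hr - r E (some j) none * this
          · rw [if_neg h, if_neg (fun h' => h h'.symm)]
            simp
        have k1 := aux n m
        have k2 := aux m n
        linear_combination k1 - k2
      · rw [if_neg hDE, if_neg (fun h => hDE h.symm)]
        simp
    · by_cases hmn : m = n
      · subst hmn
        simp only [if_true, piZ]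
        have aux : ∀ a b : Finset (Fin J), piY A B a * (if b ⊂ a then B a / B b else 0)
            = piY A B b * (if b ⊂ a then A a / A b else 0) := by
          intro a b
          split_ifs
          · exact piY_bal hApos hBpos a b
          · simp
        linear_combination piX η μ m * (aux D E) - piX η μ m * (aux E D)
      · rw [if_neg hmn, if_neg (fun h => hmn h.symm)]
        simp
  · have hQ' : ∀ f x, QZ lam μ r' A B f x =
        (∑ j ∈ x.1ᶜ, lam * r x.1 none (some j) * (f (x.1, x.2 + eV (some j)) - f x))
        + (∑ j ∈ x.1ᶜ, μ j (x.2 j) * r x.1 (some j) none * (f (x.1, x.2 - eV (some j)) - f x))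
        + (∑ H ∈ Finset.univ.filter (fun H => H ⊂ x.1), B x.1 / B H * (f (H, x.2) - f x))
        + ∑ I ∈ Finset.univ.filter (fun I => x.1 ⊂ I), A I / A x.1 * (f (I, x.2) - f x) := by
      intro f x
      have z : (∑ j ∈ x.1ᶜ, ∑ i ∈ x.1ᶜ, μ j (x.2 j) * r' x.1 (some j) (some i) *
          (f (x.1, x.2 - eV (some j) + eV (some i)) - f x)) = 0 := by
        refine Finset.sum_eq_zero fun j hj => Finset.sum_eq_zero fun i hi => ?_
        by_cases hij : j = i
        · subst hij
          by_cases h0 : x.2 j = 0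
          · rw [h0, hμ0]; simp
          · rw [sub_add_eV _ _ h0]; simp
        · rw [h2 _ j hj i hi hij]; simp
      have z1 : ∀ j ∈ x.1ᶜ, lam * r' x.1 none (some j) * (f (x.1, x.2 + eV (some j)) - f x)
          = lam * r x.1 none (some j) * (f (x.1, x.2 + eV (some j)) - f x) := fun j hj => by
        rw [(h1 _ j hj).1]
      have z2 : ∀ j ∈ x.1ᶜ, μ j (x.2 j) * r' x.1 (some j) none * (f (x.1, x.2 - eV (some j)) - f x)
          = μ j (x.2 j) * r x.1 (some j) none * (f (x.1, x.2 - eV (some j)) - f x) := fun j hj => by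
        rw [(h1 _ j hj).2.1]
      rw [QZ, z, add_zero, Finset.sum_congr rfl z1, Finset.sum_congr rfl z2]
    have good' : GoodOp (piZ η μ A B) (QZ lam μ r' A B) := by
      have e : QZ lam μ r' A B = _ := funext fun f => funext fun x => hQ' f x
      rw [e]
      refine GoodOp.add (GoodOp.add (GoodOp.add ?_ ?_) ?_) ?_
      · exact good_up hlam hμpos hη hC hApos hBpos M hM (fun D j => r D none (some j))
          (fun D j hj => hr1 D _ (hnone D) _ (hsome D j hj))
      · exact good_down hμ0 hμpos hη hC hApos hBpos M hM (fun D j => r D (some j) none)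
          (fun D j hj => hr1 D _ (hsome D j hj) _ (hnone D))
      · exact good_break hμpos hη hC hApos hBpos (fun D H => B D / B H) (fun D H => H ⊂ D)
          (fun D H => (div_pos (hBpos _) (hBpos _)).le)
      · exact good_break hμpos hη hC hApos hBpos (fun D H => A H / A D) (fun D H => D ⊂ H)
          (fun D H => (div_pos (hApos _) (hApos _)).le)
    set c : Finset (Fin J) → Fin J → Fin J → ℝ := fun D j i => r D (some j) (some i) with hc
    have hQ : ∀ f x, QZ lam μ r A B f x = QZ lam μ r' A B f x + ∑ j, ∑ i, Lint μ c j i f x := by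
      intro f x
      have := congrFun (congrFun (int_eq (μ := μ) c) f) x
      rw [hQ', ← this, QZ]
      ring
    have hc1 : ∀ D, ∀ j ∈ Dᶜ, ∀ i ∈ Dᶜ, 0 ≤ c D j i ∧ c D j i ≤ 1 := fun D j hj i hi =>
      hr1 D _ (hsome D j hj) _ (hsome D i hi)
    have goodI : ∀ j i, GoodOp (piZ η μ A B) (Lint μ c j i) :=
      good_int1 hμ0 hμpos hη hC hApos hBpos M hM c hc1
    have key : ∀ f : Est J → ℝ, Summable (fun x => f x * f x * piZ η μ A B x) →
        ∑' x, f x * -(QZ lam μ r' A B f x) * piZ η μ A B x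
          ≤ ∑' x, f x * -(QZ lam μ r A B f x) * piZ η μ A B x := by
      intro f hf
      obtain ⟨K, hK⟩ := good'
      have s1 := (hK f hf).1
      obtain ⟨K2, hK2⟩ := GoodOp.sum Finset.univ _
        (fun j => GoodOp.sum Finset.univ _ (fun i => goodI j i))
      have s2 := (hK2 f hf).1
      have s3 := int_nonpos hμ0 hμpos hη hC hApos hBpos c
        (fun D j hj i hi => (hc1 D j hj i hi).1) hbal f
        (fun j i => by obtain ⟨K3, hK3⟩ := goodI j i; exact (hK3 f hf).1)
      have e : (fun x => f x * -(QZ lam μ r A B f x) * piZ η μ A B x) =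
          fun x => -(f x * QZ lam μ r' A B f x * piZ η μ A B x
            + f x * (∑ j, ∑ i, Lint μ c j i f x) * piZ η μ A B x) := by
        funext x; rw [hQ]; ring
      have e' : (fun x => f x * -(QZ lam μ r' A B f x) * piZ η μ A B x) =
          fun x => -(f x * QZ lam μ r' A B f x * piZ η μ A B x) := by
        funext x; ring
      rw [e, e', tsum_neg, tsum_neg, s1.tsum_add s2]
      linarith
    unfold GapZ
    by_cases hne : ∃ f : Est J → ℝ, Summable (fun x => f x * f x * piZ η μ A B x) ∧
        (∑' x, f x * piZ η μ A B x) = 0 ∧ (∑' x, f x * f x * piZ η μ A B x) = 1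
    · obtain ⟨f0, a0, b0, c0⟩ := hne
      refine le_csInf ⟨_, f0, a0, b0, c0, rfl⟩ ?_
      rintro v ⟨f, a, b, d, rfl⟩
      refine le_trans (csInf_le ?_ ⟨f, a, b, d, rfl⟩) (key f a)
      obtain ⟨K, hK⟩ := good'
      refine ⟨-K, ?_⟩
      rintro v ⟨g, a', b', d', rfl⟩
      have := (hK g a').2
      rw [d', mul_one] at this
      have e' : (fun x => g x * -(QZ lam μ r' A B g x) * piZ η μ A B x) =
          fun x => -(g x * QZ lam μ r' A B g x * piZ η μ A B x) := by
        funext x; ring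
      rw [e', tsum_neg]
      linarith
    · have emp : ∀ Q : (Est J → ℝ) → Est J → ℝ, {v : ℝ | ∃ f : Est J → ℝ,
          Summable (fun x => f x * f x * piZ η μ A B x) ∧ (∑' x, f x * piZ η μ A B x) = 0 ∧
          (∑' x, f x * f x * piZ η μ A B x) = 1 ∧
          v = ∑' x, f x * -(Q f x) * piZ η μ A B x} = ∅ := by
        intro Q
        rw [Set.eq_empty_iff_forall_notMem]
        rintro v ⟨f, a, b, d, _⟩
        exact hne ⟨f, a, b, d⟩
      rw [emp, emp]


end UnrelNet
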